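/- The greedy algorithm for s-Borda minimization produces a committee T_k of size k with score r_V(T_k) ≤ 2s²·(m+1)/(k+1), and hence is a (1 − 2s/(k+1))-approximation to the maximization version (where each voter's satisfaction for T is Σ over her top-s committee members of (m + 1 − rank)). -/

import Mathlib

/-- The sum of the `s` smallest elements of `S`. -/
def sumSmallest (s : ℕ) (S : Finset ℕ) : ℕ := ((S.sort (· ≤ ·)).take s).sum

theorem exists_sumSmallest_eq {s : ℕ} {S : Finset ℕ} (h : s ≤ S.card) :
    ∃ Q ⊆ S, Q.card = s ∧ sumSmallest s S = ∑ q ∈ Q, q ∧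
      ∀ x ∈ S, x ∉ Q → ∀ q ∈ Q, q ≤ x := by
  have hsplit := List.take_append_drop s (S.sort (· ≤ ·))
  have hnd : ((S.sort (· ≤ ·)).take s).Nodup :=
    (S.sort_nodup (· ≤ ·)).sublist (List.take_sublist _ _)
  have hpw := S.pairwise_sort (· ≤ ·)
  rw [← hsplit, List.pairwise_append] at hpw
  refine ⟨((S.sort (· ≤ ·)).take s).toFinset, ?_, ?_, ?_, ?_⟩
  · intro x hx
    exact (Finset.mem_sort (· ≤ ·)).1 (List.mem_of_mem_take (List.mem_toFinset.1 hx))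
  · rw [List.toFinset_card_of_nodup hnd, List.length_take, Finset.length_sort]
    exact min_eq_left h
  · rw [List.sum_toFinset _ hnd, List.map_id']
    rfl
  · intro x hx hxQ q hq
    rw [List.mem_toFinset] at hxQ hq
    have hx' := (Finset.mem_sort (· ≤ ·)).2 hx
    rw [← hsplit, List.mem_append] at hx'
    exact hpw.2.2 q hq x (hx'.resolve_left hxQ)

theorem sumSmallest_le_sum {S Q : Finset ℕ} (hQ : Q ⊆ S) :
    sumSmallest Q.card S ≤ ∑ q ∈ Q, q := by
  obtain ⟨P, hPS, hcard, hsum, hsep⟩ := exists_sumSmallest_eq (Finset.card_le_card hQ)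
  rw [hsum, ← Finset.sum_sdiff_le_sum_sdiff]
  have hc : (P \ Q).card = (Q \ P).card := Finset.card_sdiff_comm hcard
  rcases (P \ Q).eq_empty_or_nonempty with h | h
  · simp [h]
  · obtain ⟨a, ha, hmax⟩ := Finset.exists_max_image (P \ Q) id h
    calc ∑ q ∈ P \ Q, q ≤ (P \ Q).card • a := Finset.sum_le_card_nsmul _ _ _ hmax
      _ = (Q \ P).card • a := by rw [hc]
      _ ≤ ∑ q ∈ Q \ P, q := Finset.card_nsmul_le_sum _ _ _ fun x hx => by
          rw [Finset.mem_sdiff] at hx ha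
          exact hsep x (hQ hx.1) hx.2 a ha.1

theorem card_mul_pred_le_two_mul_sum (Q : Finset ℕ) :
    (Q.card : ℝ) * (Q.card - 1) ≤ 2 * ∑ q ∈ Q, (q : ℝ) := by
  induction Q using Finset.induction_on_max with
  | empty => simp
  | insert a Q ha ih =>
    have hna : a ∉ Q := fun h => lt_irrefl _ (ha a h)
    have hle : (Q.card : ℝ) ≤ a := by
      have := Finset.card_le_card (t := Finset.range a) fun x hx => Finset.mem_range.2 (ha x hx)
      rw [Finset.card_range] at this
      exact_mod_cast this
    rw [Finset.card_insert_of_notMem hna, Finset.sum_insert hna]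
    push_cast
    linarith

/-- A lower bound, in terms of the mean `x` of the `s` smallest elements of a set of ranks, on the
total decrease of their sum over all one-element extensions of the set. -/
noncomputable def gainBound (s x : ℝ) : ℝ := (x - (s + 1) / 2) * (x + 3 * (s - 1) / 2) / 2

theorem gainBound_le_of_max {Q : Finset ℕ} {A : ℕ} (hQ : Q.Nonempty) (hA : ∀ q ∈ Q, q ≤ A)
    (hpos : ∀ q ∈ Q, 1 ≤ q) :
    gainBound Q.card ((∑ q ∈ Q, (q : ℝ)) / Q.card) ≤
      (A : ℝ) * (A - 1) / 2 - (Q.card * A - ∑ q ∈ Q, (q : ℝ)) := by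
  have hs : (1 : ℝ) ≤ Q.card := by exact_mod_cast hQ.card_pos
  have hlow : (Q.card : ℝ) * (Q.card - 1) ≤ 2 * (∑ q ∈ Q, (q : ℝ) - Q.card) := by
    have h := card_mul_pred_le_two_mul_sum (Q.image fun q => q - 1)
    have hinj : Set.InjOn (fun q => q - 1) (Q : Set ℕ) := fun x hx y hy hxy => by
      have := hpos x hx
      have := hpos y hy
      simp only at hxy
      omega
    rw [Finset.card_image_of_injOn hinj, Finset.sum_image hinj] at h
    refine h.trans_eq ?_
    rw [Finset.sum_congr rfl fun q hq => Nat.cast_pred (R := ℝ) (hpos q hq)]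
    simp
  have hhigh : (Q.card : ℝ) * (Q.card - 1) ≤ 2 * (Q.card * A - ∑ q ∈ Q, (q : ℝ)) := by
    have h := card_mul_pred_le_two_mul_sum (Q.image fun q => A - q)
    have hinj : Set.InjOn (fun q => A - q) (Q : Set ℕ) := fun x hx y hy hxy => by
      have := hA x hx
      have := hA y hy
      simp only at hxy
      omega
    rw [Finset.card_image_of_injOn hinj, Finset.sum_image hinj] at h
    refine h.trans_eq ?_
    rw [Finset.sum_congr rfl fun q hq => Nat.cast_sub (R := ℝ) (hA q hq)]
    simp
  have hsA : Q.card ≤ A := by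
    have := Finset.card_le_card (t := Finset.Icc 1 A) fun q hq =>
      Finset.mem_Icc.2 ⟨hpos q hq, hA q hq⟩
    simpa using this
  generalize (∑ q ∈ Q, (q : ℝ)) = R at *
  generalize Q.card = s at *
  obtain ⟨x, rfl⟩ : ∃ x, R = s * x := ⟨R / s, by field_simp⟩
  have hx1 : ((s : ℝ) + 1) / 2 ≤ x := by
    refine le_of_mul_le_mul_left (a := (s : ℝ)) ?_ (by linarith)
    linarith
  have hx2 : x ≤ A - ((s : ℝ) - 1) / 2 := by
    refine le_of_mul_le_mul_left (a := (s : ℝ)) ?_ (by linarith)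
    linarith
  rw [mul_div_cancel_left₀ _ (by linarith : (s : ℝ) ≠ 0), gainBound]
  have key : 0 ≤ ((A : ℝ) - (x + (s - 1) / 2)) * (A + (x + (s - 1) / 2) - (2 * s + 1)) := by
    rcases hsA.eq_or_lt with h | h
    · have h' : (s : ℝ) = A := by exact_mod_cast h
      have : (A : ℝ) - (x + (s - 1) / 2) = 0 := by linarith
      rw [this, zero_mul]
    · have h' : (s : ℝ) + 1 ≤ A := by exact_mod_cast h
      exact mul_nonneg (by linarith) (by linarith)
  linarith

theorem sum_Icc_sub (A : ℕ) : ∑ p ∈ Finset.Icc 1 A, ((A : ℝ) - p) = A * (A - 1) / 2 := by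
  induction A with
  | zero => simp
  | succ n ih =>
    rw [Finset.sum_Icc_succ_top (by omega)]
    simp only [Finset.sum_sub_distrib, Finset.sum_const, Nat.card_Icc, nsmul_eq_mul] at ih ⊢
    push_cast at ih ⊢
    linarith

theorem gainBound_le_sum_decrease {s m : ℕ} {S : Finset ℕ} (hs : 1 ≤ s) (hS : S ⊆ Finset.Icc 1 m)
    (hcard : s ≤ S.card) :
    gainBound s ((sumSmallest s S : ℝ) / s) ≤
      ∑ p ∈ Finset.Icc 1 m \ S, ((sumSmallest s S : ℝ) - sumSmallest s (insert p S)) := by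
  obtain ⟨Q, hQS, rfl, hsum, hsep⟩ := exists_sumSmallest_eq hcard
  have hQ : Q.Nonempty := Finset.card_pos.1 hs
  obtain ⟨A, hAQ, hmax⟩ := Finset.exists_max_image Q id hQ
  simp only [id] at hmax
  have hAm := (Finset.mem_Icc.1 (hS (hQS hAQ))).2
  have hsub : Finset.Icc 1 A \ Q ⊆ Finset.Icc 1 m \ S := by
    intro p hp
    simp only [Finset.mem_sdiff, Finset.mem_Icc] at hp ⊢
    refine ⟨⟨hp.1.1, hp.1.2.trans hAm⟩, fun hpS => hp.2 ?_⟩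
    rwa [hp.1.2.antisymm (hsep p hpS hp.2 A hAQ)]
  have hQA : Q ⊆ Finset.Icc 1 A := fun q hq =>
    Finset.mem_Icc.2 ⟨(Finset.mem_Icc.1 (hS (hQS hq))).1, hmax q hq⟩
  have hsum' : (sumSmallest Q.card S : ℝ) = ∑ q ∈ Q, (q : ℝ) := by rw [hsum]; push_cast; rfl
  calc gainBound Q.card ((sumSmallest Q.card S : ℝ) / Q.card)
      ≤ (A : ℝ) * (A - 1) / 2 - (Q.card * A - ∑ q ∈ Q, (q : ℝ)) := by
        rw [hsum']
        exact gainBound_le_of_max hQ hmax fun q hq => (Finset.mem_Icc.1 (hQA hq)).1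
    _ = ∑ p ∈ Finset.Icc 1 A \ Q, ((A : ℝ) - p) := by
        have h := Finset.sum_sdiff (f := fun p : ℕ => (A : ℝ) - p) hQA
        rw [sum_Icc_sub] at h
        have h2 : ∑ p ∈ Q, ((A : ℝ) - p) = Q.card * A - ∑ q ∈ Q, (q : ℝ) := by simp
        linarith
    _ ≤ ∑ p ∈ Finset.Icc 1 A \ Q,
          ((sumSmallest Q.card S : ℝ) - sumSmallest Q.card (insert p S)) := by
        refine Finset.sum_le_sum fun p hp => ?_
        have hpQ := (Finset.mem_sdiff.1 hp).2
        have hpQ' : p ∉ Q.erase A := fun h => hpQ (Finset.mem_of_mem_erase h)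
        have hle := sumSmallest_le_sum (S := insert p S) (Q := insert p (Q.erase A))
          (Finset.insert_subset_insert _ ((Finset.erase_subset _ _).trans hQS))
        rw [Finset.card_insert_of_notMem hpQ', Finset.card_erase_add_one hAQ,
          Finset.sum_insert hpQ'] at hle
        have herase := Finset.add_sum_erase Q (fun q => q) hAQ
        have : (sumSmallest Q.card (insert p S) : ℝ) + A ≤ p + sumSmallest Q.card S := by
          rw [hsum]
          exact_mod_cast (by omega : sumSmallest Q.card (insert p S) + A ≤ p + ∑ q ∈ Q, q)
        linarith
    _ ≤ _ := by
        refine Finset.sum_le_sum_of_subset_of_nonneg hsub fun p _ _ => ?_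
        have hle := sumSmallest_le_sum (hQS.trans (Finset.subset_insert p S))
        rw [← hsum] at hle
        exact sub_nonneg.2 (by exact_mod_cast hle)

theorem gainBound_mean_le {V : Type*} [Fintype V] [Nonempty V] (s : ℝ) (x : V → ℝ) :
    gainBound s ((∑ v, x v) / Fintype.card V) ≤ (∑ v, gainBound s (x v)) / Fintype.card V := by
  have hn : (0 : ℝ) < Fintype.card V := by exact_mod_cast Fintype.card_pos
  have hsq := sq_sum_le_card_mul_sum_sq (s := Finset.univ) (f := x)
  rw [Finset.card_univ] at hsq
  have hexp : ∑ v, gainBound s (x v) =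
      (∑ v, x v ^ 2) / 2 + (∑ v, x v) * ((s - 2) / 2) -
        Fintype.card V * (3 * (s - 1) * (s + 1) / 8) := by
    rw [Finset.sum_div, Finset.sum_mul, ← Finset.sum_add_distrib, ← nsmul_eq_mul,
      ← Finset.card_univ, ← Finset.sum_const, ← Finset.sum_sub_distrib]
    refine Finset.sum_congr rfl fun v _ => ?_
    rw [gainBound]
    ring
  rw [hexp, gainBound]
  generalize (Fintype.card V : ℝ) = n at *
  obtain ⟨X, hX⟩ : ∃ X, ∑ v, x v = n * X := ⟨(∑ v, x v) / n, by field_simp⟩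
  rw [hX] at hsq ⊢
  rw [mul_div_cancel_left₀ _ hn.ne', le_div_iff₀ hn]
  have : n * X ^ 2 ≤ ∑ v, x v ^ 2 := by
    refine le_of_mul_le_mul_left ?_ hn
    linarith
  linarith

theorem le_of_gainBound_le {m s j X Y : ℝ} (hs : 1 ≤ s) (hsj : s ≤ j) (hjm : j + 1 ≤ m)
    (hYX : Y ≤ X) (hgain : gainBound s X ≤ (m - j) * (s * (X - Y)))
    (hX : X ≤ 2 * s * (m + 1) / (j + 1)) : Y ≤ 2 * s * (m + 1) / (j + 2) := by
  by_contra! hY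
  have hXB := hY.trans_le hYX
  rw [div_lt_iff₀ (by linarith)] at hXB hY
  rw [le_div_iff₀ (by linarith)] at hX
  have hX2s : 2 * s ≤ X := by
    refine le_of_mul_le_mul_right (a := j + 2) ?_ (by linarith)
    nlinarith
  have hX0 : 0 < X := by linarith
  have h1 : 2 * s * (m + 1) * X ≤ X * (j + 2) * X := by gcongr
  have hb : 0 ≤ (3 * s - 2) * (j + 2) - 2 * s := by nlinarith
  have h2 := mul_le_mul_of_nonneg_right hX2s hb
  have h3 : 0 ≤ (21 / 4 * s ^ 2 - 4 * s + 3 / 4) * (j + 2 - 3) :=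
    mul_nonneg (by nlinarith) (by linarith)
  have h4 : 0 ≤ (s - 1) * (47 / 4 * s - 1 / 4) := mul_nonneg (by linarith) (by linarith)
  have hP : s * (m - j) * X ≤ gainBound s X * (j + 2) := by
    rw [gainBound]
    linarith
  have h5 : s * (m - j) * X ≤ s * (m - j) * ((X - Y) * (j + 2)) := by
    refine hP.trans ((mul_le_mul_of_nonneg_right hgain (by linarith)).trans_eq ?_)
    ring
  have h6 := le_of_mul_le_mul_left h5 (mul_pos (by linarith) (by linarith))
  linarith


/-- The greedy algorithm for `s`-Borda minimization produces a committee of size `k` with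
score at most `2s²(m+1)/(k+1)`, and hence is a `(1 − 2s/(k+1))`-approximation for the
maximization version, where the maximization score of `T` is `s(m+1) − r_V(T)` and
`M ≤ sm` is the optimal maximization score over size-`k` committees. -/
theorem greedy_s_borda {C V : Type} [Fintype C] [Fintype V] [Nonempty V]
    [DecidableEq C]
    (m k s : ℕ) (hm : Fintype.card C = m) (hs : 1 ≤ s) (hsk : s ≤ k) (hkm : k ≤ m)
    (r : V → C ≃ Fin m)
    (rV : Finset C → ℝ)
    (hrV : ∀ S : Finset C, rV S =
      (∑ v : V, (((((S.image (fun c => (r v c : ℕ) + 1)).sort (· ≤ ·)).take s).sum : ℕ) : ℝ))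
        / (Fintype.card V : ℝ))
    (T : ℕ → Finset C) (hT0 : T 0 = ∅)
    (hstep : ∀ j < k, ∃ c ∉ T j, T (j + 1) = insert c (T j) ∧
      ∀ c' ∉ T j, rV (insert c (T j)) ≤ rV (insert c' (T j)))
    (M : ℝ)
    (hMmax : ∀ S : Finset C, S.card = k → (s : ℝ) * ((m : ℝ) + 1) - rV S ≤ M)
    (hMle : M ≤ (s : ℝ) * (m : ℝ)) :
    rV (T k) ≤ 2 * (s : ℝ) ^ 2 * ((m : ℝ) + 1) / ((k : ℝ) + 1) ∧
    (s : ℝ) * ((m : ℝ) + 1) - rV (T k) ≥ (1 - 2 * (s : ℝ) / ((k : ℝ) + 1)) * M := by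
  have hrV' : ∀ S : Finset C, rV S =
      (∑ v : V, (sumSmallest s (S.image fun c => (r v c : ℕ) + 1) : ℝ)) / Fintype.card V := hrV
  have hn : (0 : ℝ) < Fintype.card V := by exact_mod_cast Fintype.card_pos
  have hs' : (1 : ℝ) ≤ s := by exact_mod_cast hs
  have hinj : ∀ v, Function.Injective fun c => (r v c : ℕ) + 1 := fun v a b h =>
    (r v).injective (Fin.ext (Nat.succ.inj h))
  have hIcc : ∀ v (S : Finset C), (S.image fun c => (r v c : ℕ) + 1) ⊆ Finset.Icc 1 m := by
    intro v S p hp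
    obtain ⟨c, -, rfl⟩ := Finset.mem_image.1 hp
    exact Finset.mem_Icc.2 ⟨by omega, (r v c).isLt⟩
  have hcardT : ∀ j ≤ k, (T j).card = j := by
    intro j
    induction j with
    | zero => simp [hT0]
    | succ j ih =>
      intro hj
      obtain ⟨c, hc, hT, -⟩ := hstep j hj
      rw [hT, Finset.card_insert_of_notMem hc, ih (by omega)]
  have htriv : ∀ S : Finset C, s ≤ S.card → rV S ≤ s * m := by
    intro S hS
    rw [hrV', div_le_iff₀ hn]
    have : ∀ v ∈ (Finset.univ : Finset V),
        (sumSmallest s (S.image fun c => (r v c : ℕ) + 1) : ℝ) ≤ s * m := by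
      intro v _
      obtain ⟨Q, hQS, hQ, hsum, -⟩ := exists_sumSmallest_eq
        (hS.trans_eq (Finset.card_image_of_injective S (hinj v)).symm)
      rw [hsum]
      have := Finset.sum_le_card_nsmul Q (fun q => q) m fun q hq =>
        (Finset.mem_Icc.1 (hIcc v S (hQS hq))).2
      rw [hQ, smul_eq_mul] at this
      exact_mod_cast this
    refine (Finset.sum_le_card_nsmul _ _ _ this).trans_eq ?_
    rw [Finset.card_univ, nsmul_eq_mul, mul_comm]
  have hanti : ∀ (S : Finset C) (c : C), s ≤ S.card → rV (insert c S) ≤ rV S := by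
    intro S c hS
    rw [hrV', hrV']
    refine div_le_div_of_nonneg_right (Finset.sum_le_sum fun v _ => ?_) hn.le
    obtain ⟨Q, hQS, rfl, hsum, -⟩ := exists_sumSmallest_eq
      (hS.trans_eq (Finset.card_image_of_injective S (hinj v)).symm)
    rw [hsum]
    exact_mod_cast sumSmallest_le_sum
      (hQS.trans (Finset.image_subset_image (Finset.subset_insert c S)))
  have hgain : ∀ S : Finset C, s ≤ S.card →
      gainBound s (rV S / s) ≤ ∑ c ∈ Sᶜ, (rV S - rV (insert c S)) := by
    intro S hS
    have hmean := gainBound_mean_le (s : ℝ)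
      fun v : V => (sumSmallest s (S.image fun c => (r v c : ℕ) + 1) : ℝ) / s
    rw [← Finset.sum_div, div_right_comm, ← hrV'] at hmean
    refine hmean.trans ?_
    have hrhs : ∑ c ∈ Sᶜ, (rV S - rV (insert c S)) =
        (∑ v : V, ∑ c ∈ Sᶜ, ((sumSmallest s (S.image fun c => (r v c : ℕ) + 1) : ℝ) -
          sumSmallest s ((insert c S).image fun c => (r v c : ℕ) + 1))) / Fintype.card V := by
      rw [Finset.sum_comm, Finset.sum_div]
      refine Finset.sum_congr rfl fun c _ => ?_
      rw [hrV', hrV', ← sub_div, ← Finset.sum_sub_distrib]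
    rw [hrhs]
    refine div_le_div_of_nonneg_right (Finset.sum_le_sum fun v _ => ?_) hn.le
    refine (gainBound_le_sum_decrease hs (hIcc v S)
      (hS.trans_eq (Finset.card_image_of_injective S (hinj v)).symm)).trans_eq ?_
    have himage : Finset.Icc 1 m \ (S.image fun c => (r v c : ℕ) + 1) =
        Sᶜ.image fun c => (r v c : ℕ) + 1 := by
      rw [Finset.compl_eq_univ_sdiff, Finset.image_sdiff _ _ (hinj v)]
      congr 1
      refine (Finset.eq_of_subset_of_card_le (hIcc v Finset.univ) ?_).symm
      rw [Finset.card_image_of_injective _ (hinj v), Finset.card_univ, hm, Nat.card_Icc]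
      omega
    rw [himage, Finset.sum_image (hinj v).injOn]
    simp only [Finset.image_insert]
  have hbound : ∀ j, s ≤ j → j ≤ k → rV (T j) / s ≤ 2 * s * ((m : ℝ) + 1) / (j + 1) := by
    intro j hsj
    induction j, hsj using Nat.le_induction with
    | base =>
      intro hk
      have h1 : rV (T s) / s ≤ m := by
        rw [div_le_iff₀ (by linarith), mul_comm]
        exact htriv _ (hcardT s hk).ge
      refine h1.trans ?_
      rw [le_div_iff₀ (by linarith)]
      have : (0 : ℝ) ≤ m := m.cast_nonneg
      nlinarith
    | succ j hsj ih =>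
      intro hk
      have hTj := hcardT j (by omega)
      obtain ⟨c, hc, hT, hmin⟩ := hstep j hk
      have hjm : (j : ℝ) + 1 ≤ m := by exact_mod_cast hk.trans hkm
      have hstep' := hgain (T j) (hsj.trans_eq hTj.symm)
      have hsum := Finset.sum_le_card_nsmul (T j)ᶜ (fun c' => rV (T j) - rV (insert c' (T j)))
        (rV (T j) - rV (T (j + 1))) fun c' hc' => by
          rw [hT]
          exact sub_le_sub_left (hmin c' (Finset.mem_compl.1 hc')) _
      rw [Finset.card_compl, hm, hTj, nsmul_eq_mul, Nat.cast_sub (by omega)] at hsum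
      have hs0 : (s : ℝ) ≠ 0 := by linarith
      have := le_of_gainBound_le (Y := rV (T (j + 1)) / s) hs' (Nat.cast_le.2 hsj) hjm
        (div_le_div_of_nonneg_right (hT ▸ hanti _ _ (hsj.trans_eq hTj.symm)) (by linarith))
        (by
          rw [mul_sub (s : ℝ), mul_div_cancel₀ _ hs0, mul_div_cancel₀ _ hs0]
          exact hstep'.trans hsum) (ih (by omega))
      push_cast
      rwa [add_assoc, one_add_one_eq_two]
  have hk0 : (0 : ℝ) < (k : ℝ) + 1 := by positivity
  have hmain : rV (T k) ≤ 2 * (s : ℝ) ^ 2 * ((m : ℝ) + 1) / ((k : ℝ) + 1) := by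
    have h := hbound k hsk le_rfl
    rw [div_le_iff₀ (by linarith)] at h
    exact h.trans_eq (by ring)
  refine ⟨hmain, ?_⟩
  have hcard := hcardT k le_rfl
  have hscore : (0 : ℝ) ≤ s * ((m : ℝ) + 1) - rV (T k) := by
    have := htriv (T k) (hsk.trans_eq hcard.symm)
    linarith
  rcases le_total 0 (1 - 2 * (s : ℝ) / ((k : ℝ) + 1)) with h | h
  · calc (1 - 2 * (s : ℝ) / ((k : ℝ) + 1)) * M
        ≤ (1 - 2 * (s : ℝ) / ((k : ℝ) + 1)) * (s * ((m : ℝ) + 1)) := by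
          gcongr
          linarith
      _ = s * ((m : ℝ) + 1) - 2 * (s : ℝ) ^ 2 * ((m : ℝ) + 1) / ((k : ℝ) + 1) := by ring
      _ ≤ _ := sub_le_sub_left hmain _
  · exact (mul_nonpos_of_nonpos_of_nonneg h (hscore.trans (hMmax _ hcard))).trans hscore
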